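/- Suppose K ⊆ L(G) is nonempty, prefix-closed, and conditionally decomposable (K = P1(K) ∥ P2(K)); each local observation map Φ_i^a is induced by the concrete sensor-attack model of G_i (with every attack language nonempty) and extended to L(G) by Φ_i^a(s) := Φ_i^a(P_i(s)); and for i = 1,2, P_i(K) is CA-controllable and CA-observable for the local plant G_i. Then the state-estimate-based CA-supervisors S_{1,CA}, S_{2,CA} achieve the global specification under attacks: L_a((S_{1,CA}^a ∧ S_{2,CA}^a)/G) = K. -/

import Mathlib

attribute [local instance] Classical.propDecidable

noncomputable section

namespace DESCA

variable {E Q R : Type*}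

/-- Natural projection onto a sub-alphabet `A`: erase all events not in `A`. -/
def proj (A : Set E) : List E → List E
  | [] => []
  | a :: s => if a ∈ A then a :: proj A s else proj A s

/-- A language is prefix-closed if it contains every prefix of each of its members. -/
def PrefixClosed (L : Set (List E)) : Prop :=
  ∀ s t : List E, s <+: t → t ∈ L → s ∈ L

/-- Prefix closure of a language. -/
def prefixClosure (L : Set (List E)) : Set (List E) :=
  {s | ∃ t ∈ L, s <+: t}

/-- Strings over the sub-alphabet `A`. -/
def Strings (A : Set E) : Set (List E) := {s | ∀ a ∈ s, a ∈ A}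

/-- Synchronous product of `L1 ⊆ A1*` and `L2 ⊆ A2*`:
`L1 ∥ L2 = P1⁻¹(L1) ∩ P2⁻¹(L2)`. -/
def sync (A1 A2 : Set E) (L1 L2 : Set (List E)) : Set (List E) :=
  {s | proj A1 s ∈ L1 ∧ proj A2 s ∈ L2}

/-- Actuator-attack alteration of a control pattern `g`:
`Δ(g) = {(g \ g') ∪ g'' : g', g'' ⊆ Eca}`. -/
def Delta (Eca : Set E) (g : Set E) : Set (Set E) :=
  {ga | ∃ g' g'', g' ⊆ Eca ∧ g'' ⊆ Eca ∧ ga = (g \ g') ∪ g''}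

/-- Large language `L_a(S^a/G)` of a single supervised system over alphabet `A`:
`ε` belongs to it, and for `s` in it and `σ ∈ A`, `s ++ [σ]` belongs to it iff
`s ++ [σ] ∈ LG` and (`σ` uncontrollable, or enabled by some attacked control
`g ∈ Sa w` for some observation `w ∈ Phi s`). -/
inductive LargeLang (A : Set E) (LG : Set (List E)) (Euc : Set E)
    (Phi : List E → Set (List E)) (Sa : List E → Set (Set E)) : List E → Prop
  | nil : LargeLang A LG Euc Phi Sa []
  | step {s : List E} {σ : E} :
      LargeLang A LG Euc Phi Sa s → σ ∈ A → s ++ [σ] ∈ LG →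
      (σ ∈ Euc ∨ ∃ w ∈ Phi s, ∃ g ∈ Sa w, σ ∈ g) →
      LargeLang A LG Euc Phi Sa (s ++ [σ])

/-- Large language `L_a((S1^a ∧ S2^a)/G)` of the conjunctively supervised system:
`ε` belongs to it, and for `s` in it and `σ`, `s ++ [σ]` belongs to it iff
`s ++ [σ] ∈ LG` and (`σ` uncontrollable or
`∃ w1 ∈ Phi1 s, ∃ w2 ∈ Phi2 s, ∃ g1 ∈ Sa1 w1, ∃ g2 ∈ Sa2 w2,`
`σ ∈ (g1 ∪ (Σ \ A1)) ∩ (g2 ∪ (Σ \ A2))`). -/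
inductive ConjLargeLang (A1 A2 : Set E) (LG : Set (List E)) (Euc : Set E)
    (Phi1 Phi2 : List E → Set (List E)) (Sa1 Sa2 : List E → Set (Set E)) :
    List E → Prop
  | nil : ConjLargeLang A1 A2 LG Euc Phi1 Phi2 Sa1 Sa2 []
  | step {s : List E} {σ : E} :
      ConjLargeLang A1 A2 LG Euc Phi1 Phi2 Sa1 Sa2 s → s ++ [σ] ∈ LG →
      (σ ∈ Euc ∨ ∃ w1 ∈ Phi1 s, ∃ w2 ∈ Phi2 s, ∃ g1 ∈ Sa1 w1, ∃ g2 ∈ Sa2 w2,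
        σ ∈ (g1 ∪ A1ᶜ) ∩ (g2 ∪ A2ᶜ)) →
      ConjLargeLang A1 A2 LG Euc Phi1 Phi2 Sa1 Sa2 (s ++ [σ])

/-- Run of a deterministic automaton with partial transition function. -/
def dfaRun (δ : Q → E → Option Q) : Q → List E → Option Q
  | q, [] => some q
  | q, σ :: s => (δ q σ).bind fun q' => dfaRun δ q' s

/-- Language generated by a DFA with partial transition function:
strings whose run from `q0` is defined. -/
def dfaLang (δ : Q → E → Option Q) (q0 : Q) : Set (List E) :=
  {s | (dfaRun δ q0 s).isSome}

/-- Restriction of the transition function to a sub-automaton with state set `QH`. -/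
def restrictDelta (δ : Q → E → Option Q) (QH : Set Q) (q : Q) (σ : E) : Option Q :=
  match δ q σ with
  | none => none
  | some q' => if q ∈ QH ∧ q' ∈ QH then some q' else none

/-- Concrete sensor-attack map `Θ^a` along the run from state `q`:
`Θ^a(σ1⋯σn) = L1 L2 ⋯ Ln` where `Lk = {σk}` for a non-attacked transition and
`Lk = A_tr` (the attack language of the transition) for an attacked transition
(those labeled by events in `Eoa`). -/
def Theta (δ : Q → E → Option Q) (Eoa : Set E) (Att : Q → E → Set (List E)) :
    Q → List E → Set (List E)
  | _, [] => {([] : List E)}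
  | q, σ :: s =>
    match δ q σ with
    | none => ∅
    | some q' =>
      {w | ∃ u v, u ∈ (if σ ∈ Eoa then Att q σ else {[σ]}) ∧
            v ∈ Theta δ Eoa Att q' s ∧ w = u ++ v}

/-- Observation map `Φ^a(s) = P(Θ^a(s))` of the concrete sensor-attack model,
projecting onto the observable events `Eo`. -/
def PhiOf (δ : Q → E → Option Q) (q0 : Q) (Eo Eoa : Set E)
    (Att : Q → E → Set (List E)) (s : List E) : Set (List E) :=
  proj Eo '' Theta δ Eoa Att q0 s

/-- CA-controllability of `K` w.r.t. plant language `LG` and event set `A`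
(`A` playing the role of `Σ_uc ∪ Σ_c^a`, possibly intersected with a local alphabet). -/
def CACont (K LG : Set (List E)) (A : Set E) : Prop :=
  ∀ s σ, s ∈ K → σ ∈ A → s ++ [σ] ∈ LG → s ++ [σ] ∈ K

/-- CA-observability of `K` w.r.t. plant language `LG` and observation map `Phi`. -/
def CAObs (K LG : Set (List E)) (Phi : List E → Set (List E)) : Prop :=
  ∀ s σ, s ++ [σ] ∈ K →
    ∃ w ∈ Phi s, ∀ s' ∈ LG, w ∈ Phi s' → s' ∈ K →
      s' ++ [σ] ∈ LG → s' ++ [σ] ∈ K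

/-- State estimate after observing `w`:
`E_H^a(w) = {q ∈ QH : ∃ s ∈ L(H), w ∈ Φ^a(s) ∧ δ_H(q0, s) = q}`. -/
def estimate (δH : Q → E → Option Q) (q0 : Q) (QH : Set Q)
    (Phi : List E → Set (List E)) (w : List E) : Set Q :=
  {q | q ∈ QH ∧ ∃ s, dfaRun δH q0 s = some q ∧ w ∈ Phi s}

/-- Disablement set: events leading from some estimated state to an illegal state. -/
def rho (δ : Q → E → Option Q) (QH : Set Q) (x : Set Q) : Set E :=
  {σ | ∃ q ∈ x, ∃ q', δ q σ = some q' ∧ q' ∉ QH}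

/-- State-estimate-based CA-supervisor:
`S_CA(w) = (Ei \ ρ(E_H^a(w))) ∪ (Euc ∩ Ei)` if `w ∈ Φ^a(L(H))`, else `Euc ∩ Ei`. -/
def CASup (δ δH : Q → E → Option Q) (q0 : Q) (QH : Set Q)
    (Phi : List E → Set (List E)) (Ei Euc : Set E) (w : List E) : Set E :=
  if ∃ s ∈ dfaLang δH q0, w ∈ Phi s then
    (Ei \ rho δ QH (estimate δH q0 QH Phi w)) ∪ (Euc ∩ Ei)
  else Euc ∩ Ei

/-- A (nondeterministic) automaton with ε-moves: transitions are labeled by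
`some σ` (an event) or `none` (ε). -/
structure ENFA (E : Type*) (Q : Type*) where
  start : Q
  step : Q → Option E → Q → Prop
  accept : Set Q

/-- `N.Reaches q s q'`: there is a run of the ε-NFA `N` from `q` to `q'`
reading the string `s`, interleaving arbitrarily many ε-moves. -/
inductive ENFA.Reaches (N : ENFA E Q) : Q → List E → Q → Prop
  | refl (q : Q) : ENFA.Reaches N q [] q
  | eps {q q' q'' : Q} {s : List E} :
      N.step q none q' → ENFA.Reaches N q' s q'' → ENFA.Reaches N q s q''
  | symb {q q' q'' : Q} {σ : E} {s : List E} :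
      N.step q (some σ) q' → ENFA.Reaches N q' s q'' →
      ENFA.Reaches N q (σ :: s) q''

/-- Marked language of an ε-NFA. -/
def ENFA.markedLang (N : ENFA E Q) : Set (List E) :=
  {s | ∃ q ∈ N.accept, N.Reaches N.start s q}

/-- Generated language of an ε-NFA: strings having at least one run from the start. -/
def ENFA.genLang (N : ENFA E Q) : Set (List E) :=
  {s | ∃ q, N.Reaches N.start s q}

/-- Attack language `A_tr = L_m(F_tr)` marked by the attack automaton attached to
the transition leaving `q` on event `σ`. -/
def Atr (Finit : Q → E → R) (Fd : Q → E → R → E → Option R)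
    (Fm : Q → E → Set R) (q : Q) (σ : E) : Set (List E) :=
  {t | ∃ r, dfaRun (Fd q σ) (Finit q σ) t = some r ∧ r ∈ Fm q σ}

/-- Transition relation of the extended automaton `G^a`: non-attacked transitions
are kept; each attacked transition `(q, σ, q')` (i.e. `σ ∈ Eoa` and `δ q σ` defined)
is replaced by an ε-transition from `q` into the attack automaton `F_tr`, the
transitions of `F_tr`, and ε-transitions from marked states of `F_tr` to `q'`. -/
inductive GaStep (δ : Q → E → Option Q) (Eoa : Set E)
    (Finit : Q → E → R) (Fd : Q → E → R → E → Option R) (Fm : Q → E → Set R) :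
    Q ⊕ Q × E × R → Option E → Q ⊕ Q × E × R → Prop
  | keep {q : Q} {σ : E} {q' : Q} :
      δ q σ = some q' → σ ∉ Eoa →
      GaStep δ Eoa Finit Fd Fm (Sum.inl q) (some σ) (Sum.inl q')
  | enter {q : Q} {σ : E} :
      σ ∈ Eoa → (δ q σ).isSome →
      GaStep δ Eoa Finit Fd Fm (Sum.inl q) none (Sum.inr (q, σ, Finit q σ))
  | inner {q : Q} {σ : E} {r : R} {τ : E} {r' : R} :
      σ ∈ Eoa → (δ q σ).isSome → Fd q σ r τ = some r' →
      GaStep δ Eoa Finit Fd Fm (Sum.inr (q, σ, r)) (some τ) (Sum.inr (q, σ, r'))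
  | exit {q : Q} {σ : E} {q' : Q} {r : R} :
      δ q σ = some q' → σ ∈ Eoa → r ∈ Fm q σ →
      GaStep δ Eoa Finit Fd Fm (Sum.inr (q, σ, r)) none (Sum.inl q')

/-- The extended ε-NFA `G^a`, whose marked states are the plant states. -/
def Ga (δ : Q → E → Option Q) (q0 : Q) (Eoa : Set E)
    (Finit : Q → E → R) (Fd : Q → E → R → E → Option R) (Fm : Q → E → Set R) :
    ENFA E (Q ⊕ Q × E × R) where
  start := Sum.inl q0
  step := GaStep δ Eoa Finit Fd Fm
  accept := Set.range Sum.inl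

/-- Relabel every transition labeled by an event not in `Eo` as an ε-transition,
keeping all other transitions and the marked states. -/
def relabel (Eo : Set E) (N : ENFA E Q) : ENFA E Q where
  start := N.start
  step := fun q a q' =>
    (∃ σ ∈ Eo, a = some σ ∧ N.step q (some σ) q') ∨
    (a = none ∧ (N.step q none q' ∨ ∃ σ, σ ∉ Eo ∧ N.step q (some σ) q'))
  accept := N.accept

theorem proj_append_mem {A : Set E} {σ : E} (hσ : σ ∈ A) (s : List E) :
    proj A (s ++ [σ]) = proj A s ++ [σ] := by
  induction s with
  | nil => simp [proj, hσ]
  | cons a s ih => by_cases ha : a ∈ A <;> simp [proj, ha, ih]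

theorem proj_append_notMem {A : Set E} {σ : E} (hσ : σ ∉ A) (s : List E) :
    proj A (s ++ [σ]) = proj A s := by
  induction s with
  | nil => simp [proj, hσ]
  | cons a s ih => by_cases ha : a ∈ A <;> simp [proj, ha, ih]

theorem dfaRun_append_singleton (δ : Q → E → Option Q) (q : Q) (s : List E) (σ : E) :
    dfaRun δ q (s ++ [σ]) = (dfaRun δ q s).bind fun q' => δ q' σ := by
  induction s generalizing q with
  | nil => simp [dfaRun]
  | cons a s ih => cases h : δ q a <;> simp [dfaRun, h, ih]

theorem restrictDelta_eq_some {δ : Q → E → Option Q} {QH : Set Q} {q q' : Q} {σ : E} :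
    restrictDelta δ QH q σ = some q' ↔ δ q σ = some q' ∧ q ∈ QH ∧ q' ∈ QH := by
  unfold restrictDelta
  cases h : δ q σ with
  | none => simp
  | some p =>
    by_cases hp : q ∈ QH ∧ p ∈ QH
    · dsimp only
      rw [if_pos hp]
      constructor
      · intro h; obtain rfl := Option.some.inj h; exact ⟨rfl, hp⟩
      · exact And.left
    · simp only [hp, if_false, Option.some.injEq, reduceCtorEq, false_iff]
      rintro ⟨rfl, h'⟩; exact hp h'

/-- A run of the sub-automaton is a run of the plant that stays in the sub-automaton. -/
theorem dfaRun_restrictDelta {δ : Q → E → Option Q} {QH : Set Q} {q q' : Q} {s : List E}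
    (hq : q ∈ QH) (h : dfaRun (restrictDelta δ QH) q s = some q') :
    dfaRun δ q s = some q' ∧ q' ∈ QH := by
  induction s generalizing q with
  | nil =>
    simp only [dfaRun, Option.some.injEq] at h ⊢
    exact ⟨h, h ▸ hq⟩
  | cons a s ih =>
    simp only [dfaRun, Option.bind_eq_some_iff] at h ⊢
    obtain ⟨p, hp, hr⟩ := h
    obtain ⟨hp, -, hpQ⟩ := restrictDelta_eq_some.1 hp
    obtain ⟨h1, h2⟩ := ih hpQ hr
    exact ⟨⟨p, hp, h1⟩, h2⟩

theorem append_singleton_mem_dfaLang {δ : Q → E → Option Q} {q0 : Q} {s : List E} {σ : E} :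
    s ++ [σ] ∈ dfaLang δ q0 ↔ ∃ q q', dfaRun δ q0 s = some q ∧ δ q σ = some q' := by
  simp only [dfaLang, Set.mem_ofPred_eq, dfaRun_append_singleton, Option.isSome_iff_exists,
    Option.bind_eq_some_iff]
  exact exists_comm

theorem Theta_nonempty {δ : Q → E → Option Q} {Eoa : Set E} {Att : Q → E → Set (List E)}
    (hAtt : ∀ q σ, σ ∈ Eoa → (δ q σ).isSome → (Att q σ).Nonempty)
    {q : Q} {s : List E} (hs : s ∈ dfaLang δ q) : (Theta δ Eoa Att q s).Nonempty := by
  induction s generalizing q with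
  | nil => exact ⟨[], rfl⟩
  | cons σ s ih =>
    cases h : δ q σ with
    | none => simp [dfaLang, dfaRun, h] at hs
    | some q' =>
      have hs' : s ∈ dfaLang δ q' := by simpa [dfaLang, dfaRun, h] using hs
      obtain ⟨v, hv⟩ := ih hs'
      have hu : (if σ ∈ Eoa then Att q σ else {[σ]}).Nonempty := by
        split_ifs with hσ
        · exact hAtt q σ hσ (by simp [h])
        · exact Set.singleton_nonempty _
      obtain ⟨u, hu⟩ := hu
      refine ⟨u ++ v, ?_⟩
      simp only [Theta, h]
      exact ⟨u, v, hu, hv, rfl⟩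

theorem self_mem_Delta (A g : Set E) : g ∈ Delta A g :=
  ⟨∅, ∅, Set.empty_subset _, Set.empty_subset _, by simp⟩

/-- Events enabled by an attacked CA-supervisor after a legal string keep it legal. -/
theorem append_mem_of_mem_Delta_CASup {δ : Q → E → Option Q} {q0 : Q} {QH : Set Q}
    (hq0 : q0 ∈ QH) {Phi : List E → Set (List E)} {A Euc Eca : Set E}
    (hc : CACont (dfaLang (restrictDelta δ QH) q0) (dfaLang δ q0) ((Euc ∪ Eca) ∩ A))
    {s w : List E} {σ : E} {g : Set E}
    (hs : s ∈ dfaLang (restrictDelta δ QH) q0) (hσ : s ++ [σ] ∈ dfaLang δ q0)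
    (hw : w ∈ Phi s)
    (hg : g ∈ Delta (Eca ∩ A) (CASup δ (restrictDelta δ QH) q0 QH Phi A Euc w))
    (hσg : σ ∈ g) : s ++ [σ] ∈ dfaLang (restrictDelta δ QH) q0 := by
  obtain ⟨g', g'', -, hg'', rfl⟩ := hg
  rcases hσg with ⟨hS, -⟩ | hσ'
  · rw [CASup, if_pos ⟨s, hs, hw⟩] at hS
    rcases hS with ⟨-, hr⟩ | ⟨hu, hA⟩
    · obtain ⟨p, hp⟩ := Option.isSome_iff_exists.1 hs
      obtain ⟨hp', hpQ⟩ := dfaRun_restrictDelta hq0 hp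
      obtain ⟨q, q', hq, hq'⟩ := append_singleton_mem_dfaLang.1 hσ
      obtain rfl : p = q := Option.some.inj (hp'.symm.trans hq)
      refine append_singleton_mem_dfaLang.2
        ⟨p, q', hp, restrictDelta_eq_some.2 ⟨hq', hpQ, ?_⟩⟩
      by_contra hn
      exact hr ⟨p, ⟨hpQ, s, hp, hw⟩, q', hq', hn⟩
    · exact hc s σ hs ⟨Or.inl hu, hA⟩ hσ
  · exact hc s σ hs ⟨Or.inr (hg'' hσ').1, (hg'' hσ').2⟩ hσ

/-- Under CA-observability, a legal continuation is enabled by the CA-supervisor after some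
attacked observation. -/
theorem exists_mem_CASup {δ : Q → E → Option Q} {q0 : Q} {QH : Set Q}
    (hq0 : q0 ∈ QH) {Phi : List E → Set (List E)} {A Euc : Set E}
    (ho : CAObs (dfaLang (restrictDelta δ QH) q0) (dfaLang δ q0) Phi)
    {s : List E} {σ : E} (hσA : σ ∈ A)
    (hσ : s ++ [σ] ∈ dfaLang (restrictDelta δ QH) q0) :
    ∃ w ∈ Phi s, σ ∈ CASup δ (restrictDelta δ QH) q0 QH Phi A Euc w := by
  obtain ⟨w, hw, hob⟩ := ho s σ hσ
  have hs : s ∈ dfaLang (restrictDelta δ QH) q0 := by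
    obtain ⟨q, -, hq, -⟩ := append_singleton_mem_dfaLang.1 hσ
    exact Option.isSome_iff_exists.2 ⟨q, hq⟩
  refine ⟨w, hw, ?_⟩
  rw [CASup, if_pos ⟨s, hs, hw⟩]
  refine Or.inl ⟨hσA, ?_⟩
  rintro ⟨q, ⟨-, s', hs', hw'⟩, q', hq', hn⟩
  have hrun := (dfaRun_restrictDelta hq0 hs').1
  have hmem := hob s' (Option.isSome_iff_exists.2 ⟨q, hrun⟩) hw'
    (Option.isSome_iff_exists.2 ⟨q, hs'⟩)
    (append_singleton_mem_dfaLang.2 ⟨q, q', hrun, hq'⟩)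
  obtain ⟨p, p', hp, hp'⟩ := append_singleton_mem_dfaLang.1 hmem
  obtain rfl : q = p := Option.some.inj (hs'.symm.trans hp)
  obtain ⟨hp1, -, hp2⟩ := restrictDelta_eq_some.1 hp'
  obtain rfl : q' = p' := Option.some.inj (hq'.symm.trans hp1)
  exact hn hp2

/-- One step of the inclusion of the large language in the specification, for one component. -/
theorem proj_append_mem_of_enabled {δ : Q → E → Option Q} {q0 : Q} {QH : Set Q}
    (hq0 : q0 ∈ QH) {Phi : List E → Set (List E)} {A Euc Eca : Set E}
    (hc : CACont (dfaLang (restrictDelta δ QH) q0) (dfaLang δ q0) ((Euc ∪ Eca) ∩ A))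
    {s : List E} {σ : E}
    (hs : proj A s ∈ dfaLang (restrictDelta δ QH) q0)
    (hσ : proj A (s ++ [σ]) ∈ dfaLang δ q0)
    (hen : σ ∈ Euc ∨ ∃ w ∈ Phi (proj A s),
      ∃ g ∈ Delta (Eca ∩ A) (CASup δ (restrictDelta δ QH) q0 QH Phi A Euc w), σ ∈ g ∪ Aᶜ) :
    proj A (s ++ [σ]) ∈ dfaLang (restrictDelta δ QH) q0 := by
  by_cases hA : σ ∈ A
  · rw [proj_append_mem hA] at hσ ⊢
    rcases hen with hu | ⟨w, hw, g, hg, hσg | hn⟩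
    · exact hc _ σ hs ⟨Or.inl hu, hA⟩ hσ
    · exact append_mem_of_mem_Delta_CASup hq0 hc hs hσ hw hg hσg
    · exact absurd hA hn
  · rwa [proj_append_notMem hA]

/-- One step of the inclusion of the specification in the large language, for one component. -/
theorem exists_enabled_of_proj_append_mem {δ : Q → E → Option Q} {q0 : Q} {QH : Set Q}
    (hq0 : q0 ∈ QH) {Eo Eoa : Set E} {Att : Q → E → Set (List E)} {A Euc Eca : Set E}
    (hAtt : ∀ q σ, σ ∈ Eoa → (δ q σ).isSome → (Att q σ).Nonempty)
    (ho : CAObs (dfaLang (restrictDelta δ QH) q0) (dfaLang δ q0) (PhiOf δ q0 Eo Eoa Att))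
    {s : List E} {σ : E}
    (hσ : proj A (s ++ [σ]) ∈ dfaLang (restrictDelta δ QH) q0) :
    ∃ w ∈ PhiOf δ q0 Eo Eoa Att (proj A s),
      ∃ g ∈ Delta (Eca ∩ A)
        (CASup δ (restrictDelta δ QH) q0 QH (PhiOf δ q0 Eo Eoa Att) A Euc w),
      σ ∈ g ∪ Aᶜ := by
  by_cases hA : σ ∈ A
  · rw [proj_append_mem hA] at hσ
    obtain ⟨w, hw, h⟩ := exists_mem_CASup (Euc := Euc) hq0 ho hA hσ
    exact ⟨w, hw, _, self_mem_Delta _ _, Or.inl h⟩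
  · rw [proj_append_notMem hA] at hσ
    obtain ⟨q, hq⟩ := Option.isSome_iff_exists.1 hσ
    obtain ⟨t, ht⟩ := Theta_nonempty hAtt (s := proj A s)
      (Option.isSome_iff_exists.2 ⟨q, (dfaRun_restrictDelta hq0 hq).1⟩)
    exact ⟨_, ⟨t, ht, rfl⟩, _, self_mem_Delta _ _, Or.inr hA⟩

/-- final result of the paper: if `K` is nonempty, prefix-closed and
conditionally decomposable, the observation maps come from the concrete sensor-attack
models (nonempty attack languages) extended by `Φ_i^a(s) := Φ_i^a(P_i(s))`, and each
`P_i(K)` is CA-controllable and CA-observable, then the state-estimate-based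
CA-supervisors achieve `K`: `L_a((S_{1,CA}^a ∧ S_{2,CA}^a)/G) = K`. -/
theorem CASups_achieve_K {E Q1 Q2 : Type*} [Fintype E]
    (E1 E2 Eo Ec Eca : Set E)
    (hcover : E1 ∪ E2 = Set.univ) (hca : Eca ⊆ Ec)
    (δ1 : Q1 → E → Option Q1) (q10 : Q1) (δ2 : Q2 → E → Option Q2) (q20 : Q2)
    (hδ1 : ∀ q σ q', δ1 q σ = some q' → σ ∈ E1)
    (hδ2 : ∀ q σ q', δ2 q σ = some q' → σ ∈ E2)
    (Eoa1 Eoa2 : Set E) (hoa1 : Eoa1 ⊆ E1 ∩ Eo) (hoa2 : Eoa2 ⊆ E2 ∩ Eo)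
    (Att1 : Q1 → E → Set (List E)) (Att2 : Q2 → E → Set (List E))
    (hAtt1str : ∀ q σ, Att1 q σ ⊆ Strings E1)
    (hAtt2str : ∀ q σ, Att2 q σ ⊆ Strings E2)
    (hAtt1ne : ∀ q σ, σ ∈ Eoa1 → (δ1 q σ).isSome → (Att1 q σ).Nonempty)
    (hAtt2ne : ∀ q σ, σ ∈ Eoa2 → (δ2 q σ).isSome → (Att2 q σ).Nonempty)
    (K : Set (List E)) (hKne : K.Nonempty) (hKpc : PrefixClosed K)
    (hKsub : K ⊆ sync E1 E2 (dfaLang δ1 q10) (dfaLang δ2 q20))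
    -- conditional decomposability
    (hdec : K = sync E1 E2 (proj E1 '' K) (proj E2 '' K))
    -- sub-automata H_i of G_i generating P_i(K) = L(H_i)
    (QH1 : Set Q1) (hq10 : q10 ∈ QH1) (QH2 : Set Q2) (hq20 : q20 ∈ QH2)
    (hH1 : dfaLang (restrictDelta δ1 QH1) q10 = proj E1 '' K)
    (hH2 : dfaLang (restrictDelta δ2 QH2) q20 = proj E2 '' K)
    -- CA-controllability and CA-observability of P_i(K)
    (hc1 : CACont (proj E1 '' K) (dfaLang δ1 q10) ((Ecᶜ ∪ Eca) ∩ E1))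
    (ho1 : CAObs (proj E1 '' K) (dfaLang δ1 q10)
      (PhiOf δ1 q10 (E1 ∩ Eo) Eoa1 Att1))
    (hc2 : CACont (proj E2 '' K) (dfaLang δ2 q20) ((Ecᶜ ∪ Eca) ∩ E2))
    (ho2 : CAObs (proj E2 '' K) (dfaLang δ2 q20)
      (PhiOf δ2 q20 (E2 ∩ Eo) Eoa2 Att2)) :
    {s | ConjLargeLang E1 E2
        (sync E1 E2 (dfaLang δ1 q10) (dfaLang δ2 q20)) Ecᶜ
        (fun s => PhiOf δ1 q10 (E1 ∩ Eo) Eoa1 Att1 (proj E1 s))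
        (fun s => PhiOf δ2 q20 (E2 ∩ Eo) Eoa2 Att2 (proj E2 s))
        (fun w => Delta (Eca ∩ E1)
          (CASup δ1 (restrictDelta δ1 QH1) q10 QH1
            (PhiOf δ1 q10 (E1 ∩ Eo) Eoa1 Att1) E1 Ecᶜ w))
        (fun w => Delta (Eca ∩ E2)
          (CASup δ2 (restrictDelta δ2 QH2) q20 QH2
            (PhiOf δ2 q20 (E2 ∩ Eo) Eoa2 Att2) E2 Ecᶜ w)) s} = K := by
  have hpK : ∀ s, s ∈ K ↔ proj E1 s ∈ dfaLang (restrictDelta δ1 QH1) q10 ∧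
      proj E2 s ∈ dfaLang (restrictDelta δ2 QH2) q20 := fun s => by
    rw [hH1, hH2]
    exact Set.ext_iff.1 hdec s
  rw [← hH1] at hc1 ho1
  rw [← hH2] at hc2 ho2
  ext s
  constructor
  · intro h
    induction h with
    | nil => exact hKne.elim fun t ht => hKpc [] t List.nil_prefix ht
    | @step s σ _ hG hen ih =>
      obtain ⟨h1, h2⟩ := (hpK s).1 ih
      refine (hpK _).2 ⟨proj_append_mem_of_enabled (Phi := PhiOf δ1 q10 (E1 ∩ Eo) Eoa1 Att1)
          hq10 hc1 h1 hG.1 ?_,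
        proj_append_mem_of_enabled (Phi := PhiOf δ2 q20 (E2 ∩ Eo) Eoa2 Att2)
          hq20 hc2 h2 hG.2 ?_⟩
      · exact hen.imp_right fun ⟨w, hw, _, _, g, hg, _, _, h⟩ => ⟨w, hw, g, hg, h.1⟩
      · exact hen.imp_right fun ⟨_, _, w, hw, _, _, g, hg, h⟩ => ⟨w, hw, g, hg, h.2⟩
  · intro h
    induction s using List.reverseRecOn with
    | nil => exact ConjLargeLang.nil
    | append_singleton s σ ih =>
      obtain ⟨h1, h2⟩ := (hpK _).1 h
      obtain ⟨w1, hw1, g1, hg1, hσ1⟩ :=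
        exists_enabled_of_proj_append_mem hq10 hAtt1ne ho1 h1
      obtain ⟨w2, hw2, g2, hg2, hσ2⟩ :=
        exists_enabled_of_proj_append_mem hq20 hAtt2ne ho2 h2
      exact ConjLargeLang.step (ih (hKpc s _ (List.prefix_append s [σ]) h)) (hKsub h)
        (Or.inr ⟨w1, hw1, w2, hw2, g1, hg1, g2, hg2, hσ1, hσ2⟩)

end DESCA

end
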